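/- Let m, n ≥ 2 with m·n > 6, and let ρ : Matrix (Fin m × Fin n) (Fin m × Fin n) ℂ be positive semidefinite with trace 1. If ρ is not separable, then there exists a block-positive matrix W that is not decomposable such that re(tr(W * ρ)) < 0. (In particular W is a nondecomposable entanglement witness detecting ρ: every entangled state beyond the two-qubit and qubit-qutrit systems can be detected by an NDEW.) -/

import Mathlib

open Matrix ComplexOrder

noncomputable section

/-- The product vector `a ⊗ b`. -/
def prodVec {m n : ℕ} (a : Fin m → ℂ) (b : Fin n → ℂ) : Fin m × Fin n → ℂ :=
  fun p => a p.1 * b p.2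

/-- `W` is block-positive: Hermitian, and the quadratic form on every product
vector is real and nonnegative. -/
def BlockPositive {m n : ℕ} (W : Matrix (Fin m × Fin n) (Fin m × Fin n) ℂ) : Prop :=
  W.IsHermitian ∧ ∀ (a : Fin m → ℂ) (b : Fin n → ℂ),
    0 ≤ (star (prodVec a b) ⬝ᵥ W.mulVec (prodVec a b)).re ∧
    (star (prodVec a b) ⬝ᵥ W.mulVec (prodVec a b)).im = 0

/-- Partial transpose: `M^Γ ((i,k),(j,l)) = M ((j,k),(i,l))`. -/
def ptrans {m n : ℕ} (M : Matrix (Fin m × Fin n) (Fin m × Fin n) ℂ) :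
    Matrix (Fin m × Fin n) (Fin m × Fin n) ℂ :=
  fun p q => M (q.1, p.2) (p.1, q.2)

/-- `W` is decomposable: `W = P + Q^Γ` with `P, Q` positive semidefinite. -/
def Decomposable {m n : ℕ} (W : Matrix (Fin m × Fin n) (Fin m × Fin n) ℂ) : Prop :=
  ∃ P Q : Matrix (Fin m × Fin n) (Fin m × Fin n) ℂ,
    P.PosSemidef ∧ Q.PosSemidef ∧ W = P + ptrans Q

/-- Negativity: absolute value of the sum of the negative eigenvalues. -/
noncomputable def negativity {N : Type*} [Fintype N] [DecidableEq N]
    {W : Matrix N N ℂ} (hW : W.IsHermitian) : ℝ :=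
  ∑ i, max (-(hW.eigenvalues i)) 0

/-- The eigenvalues of a Hermitian matrix, listed in non-increasing order with
multiplicity. -/
noncomputable def sortedEigs {N : Type*} [Fintype N] [DecidableEq N]
    {W : Matrix N N ℂ} (hW : W.IsHermitian) : List ℝ :=
  (Finset.univ.val.map hW.eigenvalues).sort (· ≥ ·)

/-- `ρ` is a separable state. -/
def Separable {m n : ℕ} (ρ : Matrix (Fin m × Fin n) (Fin m × Fin n) ℂ) : Prop :=
  ∃ (k : ℕ) (p : Fin k → ℝ) (v : Fin k → Fin m → ℂ) (w : Fin k → Fin n → ℂ),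
    (∀ i, 0 ≤ p i) ∧ (∑ i, p i) = 1 ∧
    (∀ i, ∑ q, Complex.normSq (prodVec (v i) (w i) q) = 1) ∧
    ρ = ∑ i, ((p i : ℂ)) •
      Matrix.vecMulVec (prodVec (v i) (w i)) (star (prodVec (v i) (w i)))

/-- The convex hull of a compact set in a finite-dimensional real space is compact. -/
lemma isCompact_convexHull_aux {E : Type*} [NormedAddCommGroup E] [NormedSpace ℝ E]
    [FiniteDimensional ℝ E] {s : Set E} (hs : IsCompact s) : IsCompact (convexHull ℝ s) := by
  classical
  rcases s.eq_empty_or_nonempty with rfl | ⟨x0, hx0⟩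
  · simp
  set D := Module.finrank ℝ E + 1 with hD
  have key : convexHull ℝ s = (fun q : (Fin D → ℝ) × (Fin D → E) => ∑ i, q.1 i • q.2 i) ''
      ((stdSimplex ℝ (Fin D)) ×ˢ (Set.univ.pi fun _ => s)) := by
    apply Set.Subset.antisymm
    · intro x hx
      obtain ⟨ι, _, z, w, hz, hai, hw, hw1, hx⟩ := eq_pos_convex_span_of_mem_convexHull hx
      have hcard : Fintype.card ι ≤ D := by
        have h1 := hai.card_le_finrank_succ
        have h2 := Submodule.finrank_le (vectorSpan ℝ (Set.range z))
        omega
      obtain ⟨e⟩ : Nonempty (ι ↪ Fin D) :=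
        Function.Embedding.nonempty_of_card_le (by simpa using hcard)
      refine ⟨(Function.extend e w 0, Function.extend e z (fun _ => x0)), ⟨⟨?_, ?_⟩, ?_⟩, ?_⟩
      · intro i
        by_cases hi : ∃ j, e j = i
        · obtain ⟨j, rfl⟩ := hi
          simpa [e.injective.extend_apply] using (hw j).le
        · simp [Function.extend_apply' _ _ _ hi]
      · rw [← hw1]
        symm
        apply Fintype.sum_of_injective e e.injective
        · intro i hi
          simp only
          rw [Function.extend_apply' _ _ _ (by simpa using hi)]; rfl
        · intro i; simp [e.injective.extend_apply]
      · intro i _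
        by_cases hi : ∃ j, e j = i
        · obtain ⟨j, rfl⟩ := hi
          simpa [e.injective.extend_apply] using hz ⟨j, rfl⟩
        · simpa [Function.extend_apply' _ _ _ hi] using hx0
      · rw [← hx]
        symm
        apply Fintype.sum_of_injective e e.injective
        · intro i hi
          simp only
          rw [Function.extend_apply' w _ _ (by simpa using hi)]; simp
        · intro i; simp [e.injective.extend_apply]
    · rintro _ ⟨⟨w, z⟩, ⟨hw, hz⟩, rfl⟩
      exact mem_convexHull_of_exists_fintype w z hw.1 hw.2 (fun i => hz i trivial) rfl
  rw [key]
  apply IsCompact.image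
  · exact (isCompact_stdSimplex ℝ (Fin D)).prod (isCompact_univ_pi fun _ => hs)
  · fun_prop

lemma isCompact_unit (m : ℕ) : IsCompact {v : Fin m → ℂ | ∑ i, Complex.normSq (v i) = 1} := by
  apply Metric.isCompact_of_isClosed_isBounded
  · apply isClosed_eq _ continuous_const
    exact continuous_finsetSum _ fun i _ => Complex.continuous_normSq.comp (continuous_apply i)
  · rw [Metric.isBounded_iff_subset_closedBall 0]
    refine ⟨1, fun v hv => ?_⟩
    rw [mem_closedBall_zero_iff, pi_norm_le_iff_of_nonneg zero_le_one]
    intro i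
    have h1 : Complex.normSq (v i) ≤ 1 := by
      rw [← (hv : ∑ i, Complex.normSq (v i) = 1)]
      exact Finset.single_le_sum (f := fun i => Complex.normSq (v i))
        (fun j _ => Complex.normSq_nonneg _) (Finset.mem_univ i)
    rw [Complex.normSq_eq_norm_sq] at h1
    nlinarith [norm_nonneg (v i)]

lemma sum_normSq_prodVec {m n : ℕ} (a : Fin m → ℂ) (b : Fin n → ℂ) :
    ∑ q, Complex.normSq (prodVec a b q) =
      (∑ i, Complex.normSq (a i)) * ∑ j, Complex.normSq (b j) := by
  rw [Fintype.sum_prod_type, Finset.sum_mul_sum]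
  simp [prodVec]

lemma trace_mul_proj {N : Type*} [Fintype N] (W : Matrix N N ℂ) (v : N → ℂ) :
    (W * vecMulVec v (star v)).trace = star v ⬝ᵥ W *ᵥ v := by
  rw [mul_vecMulVec, trace_vecMulVec, dotProduct_comm]

/-- Real functionals on complex matrices are trace functionals. -/
lemma functional_eq_trace {N : Type*} [Fintype N] [DecidableEq N] (f : (N → N → ℂ) →ₗ[ℝ] ℝ) :
    ∃ W : Matrix N N ℂ, ∀ x : Matrix N N ℂ, f x = ((W * x).trace).re := by
  refine ⟨Matrix.of fun q p => (f (Pi.single p (Pi.single q 1)) : ℂ) -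
    Complex.I * (f (Pi.single p (Pi.single q Complex.I)) : ℂ), fun x => ?_⟩
  have hx : x = ∑ p, ∑ q, ((x p q).re • (Pi.single p (Pi.single q 1) : N → N → ℂ)
      + (x p q).im • (Pi.single p (Pi.single q Complex.I) : N → N → ℂ)) := by
    ext i j
    simp only [Finset.sum_apply, Pi.add_apply, Pi.smul_apply, Pi.single_apply, ite_apply,
      Pi.zero_apply, Complex.real_smul]
    rw [Finset.sum_eq_single i, Finset.sum_eq_single j]
    · simp [Complex.re_add_im]
    · intro b _ hb; simp [hb.symm]
    · simp
    · intro b _ hb; simp [hb.symm]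
    · simp
  conv_lhs => rw [hx]
  simp only [map_sum, map_add, map_smul, smul_eq_mul]
  simp only [Matrix.trace, Matrix.diag, Matrix.mul_apply, Complex.re_sum]
  rw [Finset.sum_comm]
  refine Finset.sum_congr rfl fun p _ => Finset.sum_congr rfl fun q _ => ?_
  simp
  ring

lemma proj_smul {m n : ℕ} (a : Fin m → ℂ) (b : Fin n → ℂ) (c d : ℝ) :
    vecMulVec (prodVec ((c : ℂ) • a) ((d : ℂ) • b)) (star (prodVec ((c : ℂ) • a) ((d : ℂ) • b))) =
      ((c ^ 2 * d ^ 2 : ℝ)) • vecMulVec (prodVec a b) (star (prodVec a b)) := by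
  ext p q
  simp [vecMulVec_apply, prodVec]
  ring

/-- Hahn–Banach: every nonseparable state is detected by a block-positive matrix. -/
lemma exists_witness {m n : ℕ} (ρ : Matrix (Fin m × Fin n) (Fin m × Fin n) ℂ)
    (hρ : ρ.IsHermitian) (htr : ρ.trace = 1) (hent : ¬ Separable ρ) :
    ∃ W : Matrix (Fin m × Fin n) (Fin m × Fin n) ℂ,
      BlockPositive W ∧ ((W * ρ).trace).re < 0 := by
  let g : (Fin m → ℂ) × (Fin n → ℂ) → (Fin m × Fin n → Fin m × Fin n → ℂ) :=
    fun x p q => prodVec x.1 x.2 p * star (prodVec x.1 x.2 q)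
  let U := {v : Fin m → ℂ | ∑ i, Complex.normSq (v i) = 1} ×ˢ
    {v : Fin n → ℂ | ∑ i, Complex.normSq (v i) = 1}
  have hg : Continuous g := by
    refine continuous_pi fun p => continuous_pi fun q => ?_
    simp only [g, prodVec]
    fun_prop
  have hK : IsCompact (g '' U) := ((isCompact_unit m).prod (isCompact_unit n)).image hg
  have hC := isCompact_convexHull_aux hK
  have hnot : (ρ : Fin m × Fin n → Fin m × Fin n → ℂ) ∉ convexHull ℝ (g '' U) := by
    intro hmem
    apply hent
    obtain ⟨ι, _, w, z, hw0, hw1, hz, hx⟩ := mem_convexHull_iff_exists_fintype.1 hmem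
    choose y hyU hy using hz
    let e := Fintype.equivFin ι
    refine ⟨Fintype.card ι, fun i => w (e.symm i), fun i => (y (e.symm i)).1,
      fun i => (y (e.symm i)).2, fun i => hw0 _, ?_, fun i => ?_, ?_⟩
    · rw [← hw1]; exact e.symm.sum_comp w
    · rw [sum_normSq_prodVec]
      have := hyU (e.symm i)
      rw [(this.1 : ∑ j, Complex.normSq ((y (e.symm i)).1 j) = 1),
        (this.2 : ∑ j, Complex.normSq ((y (e.symm i)).2 j) = 1), one_mul]
    · rw [e.symm.sum_comp (fun i => ((w i : ℂ)) •
        Matrix.vecMulVec (prodVec (y i).1 (y i).2) (star (prodVec (y i).1 (y i).2)))]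
      rw [← hx]
      ext p q
      simp only [Matrix.sum_apply, Matrix.smul_apply]
      refine Finset.sum_congr rfl fun i _ => ?_
      rw [← hy i]
      change w i • (g (y i) p q) = _
      simp [g, vecMulVec_apply]
  obtain ⟨f, u, hfu, hu⟩ := geometric_hahn_banach_point_closed (convex_convexHull ℝ (g '' U))
    hC.isClosed hnot
  obtain ⟨W0, hW0⟩ := functional_eq_trace f.toLinearMap
  have hherm : ∀ x : Matrix (Fin m × Fin n) (Fin m × Fin n) ℂ, x.IsHermitian →
      ((W0ᴴ * x).trace).re = ((W0 * x).trace).re := by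
    intro x hx
    have h1 : (W0ᴴ * x).trace = star ((W0 * x).trace) := by
      rw [← Matrix.trace_conjTranspose, conjTranspose_mul, hx.eq, Matrix.trace_mul_comm]
    rw [h1]; simp
  let W : Matrix (Fin m × Fin n) (Fin m × Fin n) ℂ :=
    ((1 / 2 : ℝ) : ℂ) • (W0 + W0ᴴ) - (u : ℂ) • 1
  have hWt : ∀ x : Matrix (Fin m × Fin n) (Fin m × Fin n) ℂ, x.IsHermitian →
      ((W * x).trace).re = f x - u * x.trace.re := by
    intro x hx
    have h2 : f x = ((W0 * x).trace).re := hW0 x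
    simp only [W, Matrix.sub_mul, Matrix.smul_mul, Matrix.add_mul, Matrix.trace_sub,
      Matrix.trace_smul, Matrix.trace_add, smul_eq_mul, Complex.sub_re, Complex.re_ofReal_mul,
      Complex.add_re, Matrix.one_mul]
    rw [hherm x hx, h2]; ring
  have hWH : W.IsHermitian := by
    unfold Matrix.IsHermitian
    simp only [W, conjTranspose_sub, conjTranspose_smul, conjTranspose_add,
      conjTranspose_conjTranspose, conjTranspose_one, Complex.star_def, Complex.conj_ofReal]
    rw [add_comm]
  refine ⟨W, ⟨hWH, fun a b => ⟨?_, ?_⟩⟩, ?_⟩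
  · set v := prodVec a b with hv
    set A := ∑ i, Complex.normSq (a i) with hA
    set B := ∑ i, Complex.normSq (b i) with hB
    have hA0 : 0 ≤ A := Finset.sum_nonneg fun i _ => Complex.normSq_nonneg _
    have hB0 : 0 ≤ B := Finset.sum_nonneg fun i _ => Complex.normSq_nonneg _
    by_cases h0 : v = 0
    · rw [h0]; simp
    have hAp : A ≠ 0 := by
      intro h
      apply h0
      rw [Finset.sum_eq_zero_iff_of_nonneg (fun i _ => Complex.normSq_nonneg _)] at h
      ext p
      have := h p.1 (Finset.mem_univ _)
      simp only [Complex.normSq_eq_zero] at this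
      simp [hv, prodVec, this]
    have hBp : B ≠ 0 := by
      intro h
      apply h0
      rw [Finset.sum_eq_zero_iff_of_nonneg (fun i _ => Complex.normSq_nonneg _)] at h
      ext p
      have := h p.2 (Finset.mem_univ _)
      simp only [Complex.normSq_eq_zero] at this
      simp [hv, prodVec, this]
    have hA1 : 0 < A := lt_of_le_of_ne hA0 (Ne.symm hAp)
    have hB1 : 0 < B := lt_of_le_of_ne hB0 (Ne.symm hBp)
    have hpr : ∀ x : Fin m × Fin n → ℂ, (vecMulVec x (star x)).IsHermitian :=
      fun x => (posSemidef_vecMulVec_self_star x).1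
    rw [← trace_mul_proj, hWt _ (hpr v)]
    have htrv : ((vecMulVec v (star v)).trace).re = A * B := by
      rw [trace_vecMulVec, ← sum_normSq_prodVec]
      simp [dotProduct, hv, Complex.mul_conj]
    rw [htrv]
    have hmem : g ((((√A)⁻¹ : ℝ) : ℂ) • a, (((√B)⁻¹ : ℝ) : ℂ) • b) ∈ convexHull ℝ (g '' U) := by
      apply subset_convexHull
      refine ⟨_, ⟨?_, ?_⟩, rfl⟩
      · simp only [Set.mem_ofPred_eq, Pi.smul_apply, smul_eq_mul, Complex.normSq_mul,
          Complex.normSq_ofReal, ← Finset.mul_sum, ← hA]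
        rw [← mul_inv, Real.mul_self_sqrt hA0, inv_mul_cancel₀ hAp]
      · simp only [Set.mem_ofPred_eq, Pi.smul_apply, smul_eq_mul, Complex.normSq_mul,
          Complex.normSq_ofReal, ← Finset.mul_sum, ← hB]
        rw [← mul_inv, Real.mul_self_sqrt hB0, inv_mul_cancel₀ hBp]
    have h3 := hu _ hmem
    have h4 : g ((((√A)⁻¹ : ℝ) : ℂ) • a, (((√B)⁻¹ : ℝ) : ℂ) • b) =
        (A⁻¹ * B⁻¹) • (vecMulVec v (star v) : Fin m × Fin n → Fin m × Fin n → ℂ) := by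
      have := proj_smul a b (√A)⁻¹ (√B)⁻¹
      rw [inv_pow, inv_pow, Real.sq_sqrt hA0, Real.sq_sqrt hB0] at this
      exact this
    have h6 : f ((A⁻¹ * B⁻¹) • (vecMulVec v (star v) : Fin m × Fin n → Fin m × Fin n → ℂ)) =
        (A⁻¹ * B⁻¹) * f (vecMulVec v (star v)) :=
      map_smul f (A⁻¹ * B⁻¹) (vecMulVec v (star v) : Fin m × Fin n → Fin m × Fin n → ℂ)
    rw [h4] at h3
    replace h3 := lt_of_lt_of_eq h3 h6
    rw [← mul_inv, inv_mul_eq_div, lt_div_iff₀ (by positivity)] at h3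
    exact sub_nonneg.2 h3.le
  · have h5 : star (star (prodVec a b) ⬝ᵥ W *ᵥ prodVec a b) =
        star (prodVec a b) ⬝ᵥ W *ᵥ prodVec a b := by
      rw [← star_dotProduct, star_mulVec, hWH.eq, dotProduct_mulVec]
    exact Complex.conj_eq_iff_im.1 h5
  · rw [hWt ρ hρ, htr]
    simpa using hfu

lemma sum_swap_first {α β γ : Type*} [Fintype α] [Fintype β] [AddCommMonoid γ]
    (F : α × β → α × β → γ) :
    ∑ x, ∑ y, F x y = ∑ x : α × β, ∑ y : α × β, F (y.1, x.2) (x.1, y.2) := by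
  rw [← Fintype.sum_prod_type', ← Fintype.sum_prod_type']
  let e : (α × β) × (α × β) ≃ (α × β) × (α × β) :=
    { toFun := fun z => ((z.2.1, z.1.2), (z.1.1, z.2.2))
      invFun := fun z => ((z.2.1, z.1.2), (z.1.1, z.2.2))
      left_inv := fun _ => rfl
      right_inv := fun _ => rfl }
  exact (e.sum_comp (fun z => F z.1 z.2)).symm

lemma trace_ptrans_mul {m n : ℕ} (A B : Matrix (Fin m × Fin n) (Fin m × Fin n) ℂ) :
    (ptrans A * B).trace = (A * ptrans B).trace := by
  simp only [Matrix.trace, Matrix.diag, Matrix.mul_apply]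
  rw [sum_swap_first]
  rfl

lemma ptrans_proj {m n : ℕ} (a : Fin m → ℂ) (b : Fin n → ℂ) :
    ptrans (vecMulVec (prodVec a b) (star (prodVec a b))) =
      vecMulVec (prodVec (star a) b) (star (prodVec (star a) b)) := by
  ext p q
  simp [ptrans, vecMulVec_apply, prodVec]
  ring

lemma ptrans_herm {m n : ℕ} {Q : Matrix (Fin m × Fin n) (Fin m × Fin n) ℂ}
    (hQ : Q.IsHermitian) : (ptrans Q).IsHermitian := by
  ext p q
  exact hQ.apply _ _

lemma ptrans_blockPositive {m n : ℕ} {Q : Matrix (Fin m × Fin n) (Fin m × Fin n) ℂ}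
    (hQ : Q.PosSemidef) : BlockPositive (ptrans Q) := by
  refine ⟨ptrans_herm hQ.1, fun a b => ?_⟩
  rw [← trace_mul_proj, trace_ptrans_mul, ptrans_proj, trace_mul_proj]
  have h := hQ.dotProduct_mulVec_nonneg (prodVec (star a) b)
  rw [Complex.le_def] at h
  exact ⟨h.1, h.2.symm⟩

open scoped MatrixOrder in
lemma trace_mul_psd_nonneg {N : Type*} [Fintype N] {P σ : Matrix N N ℂ}
    (hP : P.PosSemidef) (hσ : σ.PosSemidef) : 0 ≤ ((P * σ).trace).re := by
  classical
  obtain ⟨B, rfl⟩ := CStarAlgebra.nonneg_iff_eq_star_mul_self.mp hσ.nonneg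
  rw [star_eq_conjTranspose]
  rw [← Matrix.mul_assoc, Matrix.trace_mul_comm, ← Matrix.mul_assoc]
  have h := (hP.mul_mul_conjTranspose_same B).trace_nonneg
  rw [Complex.le_def] at h
  exact h.1

lemma BlockPositive.add {m n : ℕ} {V W : Matrix (Fin m × Fin n) (Fin m × Fin n) ℂ}
    (hV : BlockPositive V) (hW : BlockPositive W) : BlockPositive (V + W) := by
  refine ⟨hV.1.add hW.1, fun a b => ?_⟩
  rw [Matrix.add_mulVec, dotProduct_add, Complex.add_re, Complex.add_im, (hV.2 a b).2,
    (hW.2 a b).2]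
  exact ⟨add_nonneg (hV.2 a b).1 (hW.2 a b).1, by simp⟩

lemma BlockPositive.rsmul {m n : ℕ} {W : Matrix (Fin m × Fin n) (Fin m × Fin n) ℂ}
    (hW : BlockPositive W) {t : ℝ} (ht : 0 ≤ t) : BlockPositive ((t : ℂ) • W) := by
  refine ⟨?_, fun a b => ?_⟩
  · unfold Matrix.IsHermitian
    rw [conjTranspose_smul, hW.1.eq]; simp
  · rw [Matrix.smul_mulVec, dotProduct_smul, smul_eq_mul, Complex.re_ofReal_mul,
      Complex.im_ofReal_mul, (hW.2 a b).2]
    exact ⟨mul_nonneg ht (hW.2 a b).1, by simp⟩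

lemma not_decomposable_of_ppt {m n : ℕ} {W σ : Matrix (Fin m × Fin n) (Fin m × Fin n) ℂ}
    (hσ : σ.PosSemidef) (hσ' : (ptrans σ).PosSemidef) (h : ((W * σ).trace).re < 0) :
    ¬ Decomposable W := by
  rintro ⟨P, Q, hP, hQ, rfl⟩
  rw [Matrix.add_mul, Matrix.trace_add, trace_ptrans_mul, Complex.add_re] at h
  have h1 := trace_mul_psd_nonneg hP hσ
  have h2 := trace_mul_psd_nonneg hQ hσ'
  linarith

lemma detect {m n : ℕ} {ρ σ W₁ : Matrix (Fin m × Fin n) (Fin m × Fin n) ℂ}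
    (hσ : σ.PosSemidef) (hσ' : (ptrans σ).PosSemidef) (hW₁ : BlockPositive W₁)
    (hneg : ((W₁ * σ).trace).re < 0) (ψ : Fin m × Fin n → ℂ) (hψ : ptrans σ *ᵥ ψ = 0)
    (hψρ : (star ψ ⬝ᵥ ptrans ρ *ᵥ ψ).re < 0) :
    ∃ W : Matrix (Fin m × Fin n) (Fin m × Fin n) ℂ,
      BlockPositive W ∧ ¬ Decomposable W ∧ ((W * ρ).trace).re < 0 := by
  obtain ⟨t, ht, htc⟩ : ∃ t : ℝ, 0 < t ∧
      (star ψ ⬝ᵥ ptrans ρ *ᵥ ψ).re + t * ((W₁ * ρ).trace).re < 0 := by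
    set r := (star ψ ⬝ᵥ ptrans ρ *ᵥ ψ).re
    set c := ((W₁ * ρ).trace).re
    have hc : 0 < |c| + 1 := by positivity
    refine ⟨-r / (|c| + 1), div_pos (by linarith) hc, ?_⟩
    have h1 : -r / (|c| + 1) * c ≤ -r / (|c| + 1) * |c| :=
      mul_le_mul_of_nonneg_left (le_abs_self c) (div_pos (by linarith) hc).le
    have h2 : -r / (|c| + 1) * |c| < -r := by
      rw [div_mul_eq_mul_div, div_lt_iff₀ hc]
      nlinarith
    linarith
  have hcomp : ∀ x : Matrix (Fin m × Fin n) (Fin m × Fin n) ℂ,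
      (((ptrans (vecMulVec ψ (star ψ)) + (t : ℂ) • W₁) * x).trace).re =
        (star ψ ⬝ᵥ ptrans x *ᵥ ψ).re + t * ((W₁ * x).trace).re := by
    intro x
    rw [Matrix.add_mul, Matrix.trace_add, trace_ptrans_mul, Matrix.trace_mul_comm,
      trace_mul_proj, Matrix.smul_mul, Matrix.trace_smul, smul_eq_mul, Complex.add_re,
      Complex.re_ofReal_mul]
  refine ⟨ptrans (vecMulVec ψ (star ψ)) + (t : ℂ) • W₁, ?_, ?_, ?_⟩
  · exact (ptrans_blockPositive (posSemidef_vecMulVec_self_star ψ)).add (hW₁.rsmul ht.le)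
  · apply not_decomposable_of_ppt hσ hσ'
    rw [hcomp, hψ]
    simp only [dotProduct_zero, Complex.zero_re, zero_add]
    nlinarith
  · rw [hcomp]; exact htc

lemma ptrans_conj {m n p q : ℕ} (R : Matrix (Fin m) (Fin p) ℂ) (S : Matrix (Fin n) (Fin q) ℂ)
    (hR : R.map star = R) (τ : Matrix (Fin p × Fin q) (Fin p × Fin q) ℂ) :
    ptrans (kroneckerMap (· * ·) R S * τ * (kroneckerMap (· * ·) R S)ᴴ) =
      kroneckerMap (· * ·) R S * ptrans τ * (kroneckerMap (· * ·) R S)ᴴ := by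
  have hR' : ∀ i j, (starRingEnd ℂ) (R i j) = R i j := fun i j => congrFun (congrFun hR i) j
  ext x y
  simp only [ptrans, Matrix.mul_apply, Finset.sum_mul, conjTranspose_apply, kroneckerMap_apply,
    star_mul', Complex.star_def, hR']
  rw [sum_swap_first]
  refine Finset.sum_congr rfl fun a _ => Finset.sum_congr rfl fun b _ => ?_
  ring

lemma kron_prodVec {m n p q : ℕ} (A : Matrix (Fin p) (Fin m) ℂ) (B : Matrix (Fin q) (Fin n) ℂ)
    (a : Fin m → ℂ) (b : Fin n → ℂ) :
    kroneckerMap (· * ·) A B *ᵥ prodVec a b = prodVec (A *ᵥ a) (B *ᵥ b) := by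
  ext x
  simp only [prodVec, mulVec, dotProduct, kroneckerMap_apply]
  rw [Fintype.sum_prod_type, Finset.sum_mul_sum]
  refine Finset.sum_congr rfl fun a _ => Finset.sum_congr rfl fun b _ => ?_
  ring

lemma BlockPositive.conj {m n p q : ℕ} {W : Matrix (Fin p × Fin q) (Fin p × Fin q) ℂ}
    (hW : BlockPositive W) (A : Matrix (Fin p) (Fin m) ℂ) (B : Matrix (Fin q) (Fin n) ℂ) :
    BlockPositive ((kroneckerMap (· * ·) A B)ᴴ * W * kroneckerMap (· * ·) A B) := by
  refine ⟨isHermitian_conjTranspose_mul_mul _ hW.1, fun a b => ?_⟩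
  have := hW.2 (A *ᵥ a) (B *ᵥ b)
  rw [← kron_prodVec] at this
  rwa [← Matrix.mulVec_mulVec, ← Matrix.mulVec_mulVec, dotProduct_mulVec, ← star_mulVec]

/-- The inclusion matrix of the first `p` coordinates. -/
def inclMat {p m : ℕ} (h : p ≤ m) : Matrix (Fin m) (Fin p) ℂ :=
  Matrix.of fun i j => if i = Fin.castLE h j then 1 else 0

lemma inclMat_transpose_mul {p m : ℕ} (h : p ≤ m) : (inclMat h)ᵀ * inclMat h = 1 := by
  ext i j
  simp [inclMat, Matrix.mul_apply, Matrix.one_apply, eq_comm]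

lemma inclMat_real {p m : ℕ} (h : p ≤ m) : (inclMat h).map star = inclMat h := by
  ext i j
  simp only [inclMat, Matrix.map_apply, Matrix.of_apply]
  split_ifs <;> simp

lemma lift_detect {m n p q : ℕ} (hpm : p ≤ m) (hqn : q ≤ n) (hpq : p ≤ q)
    {τ W₁ : Matrix (Fin p × Fin q) (Fin p × Fin q) ℂ}
    (hτ : τ.PosSemidef) (hτ' : (ptrans τ).PosSemidef) (hW₁ : BlockPositive W₁)
    (hneg : ((W₁ * τ).trace).re < 0) (X₀ : Matrix (Fin q) (Fin q) ℂ) (hX₀ : X₀.det ≠ 0)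
    (hker : ptrans τ *ᵥ (fun x => X₀ (Fin.castLE hpq x.1) x.2) = 0)
    (ρ : Matrix (Fin m × Fin n) (Fin m × Fin n) ℂ) (φ : Fin m × Fin n → ℂ)
    (hφ : (star φ ⬝ᵥ ptrans ρ *ᵥ φ).re < 0) :
    ∃ W : Matrix (Fin m × Fin n) (Fin m × Fin n) ℂ,
      BlockPositive W ∧ ¬ Decomposable W ∧ ((W * ρ).trace).re < 0 := by
  classical
  let Y₀ : Matrix (Fin q) (Fin q) ℂ := Matrix.of fun i k =>
    if h : i.val < p then φ (⟨i.val, h.trans_le hpm⟩, Fin.castLE hqn k) else 0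
  let η : Fin m × Fin n → ℂ := fun x => if x.1.val = x.2.val then 1 else 0
  obtain ⟨ε, hε1, hε2⟩ : ∃ ε : ℂ, (star (φ + ε • η) ⬝ᵥ ptrans ρ *ᵥ (φ + ε • η)).re < 0 ∧
      (Y₀ + ε • 1).det ≠ 0 := by
    have hcont : Continuous fun ε : ℂ => (star (φ + ε • η) ⬝ᵥ ptrans ρ *ᵥ (φ + ε • η)).re := by
      simp only [dotProduct, mulVec]
      simp only [Pi.star_apply, Pi.add_apply, Pi.smul_apply]
      fun_prop
    have hopen : {ε : ℂ | (star (φ + ε • η) ⬝ᵥ ptrans ρ *ᵥ (φ + ε • η)).re < 0} ∈ nhds (0 : ℂ) :=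
      (isOpen_lt hcont continuous_const).mem_nhds (by simpa using hφ)
    have hinf := infinite_of_mem_nhds (0 : ℂ) hopen
    have hfin : {x | ((-Y₀).charpoly).IsRoot x}.Finite :=
      Polynomial.finite_setOfPred_isRoot (Matrix.charpoly_monic (-Y₀)).ne_zero
    obtain ⟨ε, h1, h2⟩ := (hinf.sdiff hfin).nonempty
    refine ⟨ε, h1, fun h3 => h2 ?_⟩
    change Polynomial.eval ε _ = 0
    rw [Matrix.eval_charpoly, sub_neg_eq_add, add_comm, ← h3]
    congr 2
    ext i j
    simp [Matrix.scalar_apply, Matrix.diagonal_apply, Matrix.one_apply]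
  set ψ := φ + ε • η with hψdef
  set Y := Y₀ + ε • (1 : Matrix (Fin q) (Fin q) ℂ) with hY
  have hYψ : ∀ (i : Fin p) (k : Fin q),
      Y (Fin.castLE hpq i) k = ψ (Fin.castLE hpm i, Fin.castLE hqn k) := by
    intro i k
    simp only [hY, hψdef, Matrix.add_apply, Matrix.smul_apply, Pi.add_apply, Pi.smul_apply, Y₀, η,
      Matrix.of_apply, Matrix.one_apply, Fin.val_castLE, i.isLt, dif_pos, Fin.ext_iff]
    rfl
  have hYu : IsUnit Y.det := isUnit_iff_ne_zero.2 hε2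
  let T := Y⁻¹ * X₀
  have hYT : Y * T = X₀ := Matrix.mul_nonsing_inv_cancel_left Y X₀ hYu
  have hTdet : T.det ≠ 0 := by
    intro h
    apply hX₀
    rw [← hYT, Matrix.det_mul, h, mul_zero]
  let T' := T.map star
  have hT' : IsUnit T'.det := by
    have : T'.det = star T.det := by
      have h := Matrix.det_conjTranspose T
      rw [← h, ← Matrix.det_transpose]; rfl
    rw [this]
    exact isUnit_iff_ne_zero.2 (by simpa using hTdet)
  let R := inclMat hpm
  let S := inclMat hqn * T'
  let A := (inclMat hpm)ᵀ
  let B := T'⁻¹ * (inclMat hqn)ᵀ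
  have hAR : A * R = 1 := inclMat_transpose_mul hpm
  have hBS : B * S = 1 := by
    simp only [B, S]
    rw [Matrix.mul_assoc, ← Matrix.mul_assoc (inclMat hqn)ᵀ, inclMat_transpose_mul, Matrix.one_mul,
      Matrix.nonsing_inv_mul _ hT']
  let M := kroneckerMap (· * ·) R S
  let N := kroneckerMap (· * ·) A B
  have hNM : N * M = 1 := by
    simp only [N, M]
    rw [← Matrix.mul_kronecker_mul, hAR, hBS, Matrix.one_kronecker_one]
  have hMN : Mᴴ * Nᴴ = 1 := by
    rw [← conjTranspose_mul, hNM, conjTranspose_one]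
  have hMψ : Mᴴ *ᵥ ψ = fun x => X₀ (Fin.castLE hpq x.1) x.2 := by
    ext ⟨i, k⟩
    rw [← hYT, Matrix.mul_apply]
    simp only [hYψ, mulVec, dotProduct, conjTranspose_apply, M, kroneckerMap_apply, R, S,
      Matrix.mul_apply, star_mul', star_sum, T', Matrix.map_apply, star_star]
    rw [Fintype.sum_prod_type, Finset.sum_eq_single (Fin.castLE hpm i)]
    · simp only [Finset.sum_mul, Finset.mul_sum]
      rw [Finset.sum_comm]
      refine Finset.sum_congr rfl fun l _ => ?_
      rw [Finset.sum_eq_single (Fin.castLE hqn l)]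
      · simp [inclMat, mul_comm]
      · intro j _ hj; simp [inclMat, hj]
      · simp
    · intro j _ hj; simp [inclMat, hj]
    · simp
  have hσ' : ptrans (M * τ * Mᴴ) = M * ptrans τ * Mᴴ := ptrans_conj R S (inclMat_real hpm) τ
  refine detect (σ := M * τ * Mᴴ) (W₁ := Nᴴ * W₁ * N) (hτ.mul_mul_conjTranspose_same M) ?_
    (hW₁.conj A B) ?_ ψ ?_ hε1
  · rw [hσ']; exact hτ'.mul_mul_conjTranspose_same M
  · have : Nᴴ * W₁ * N * (M * τ * Mᴴ) = Nᴴ * (W₁ * τ * Mᴴ) := by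
      calc Nᴴ * W₁ * N * (M * τ * Mᴴ) = Nᴴ * (W₁ * ((N * M) * τ) * Mᴴ) := by
            simp only [Matrix.mul_assoc]
        _ = _ := by rw [hNM, Matrix.one_mul]
    rw [this, Matrix.trace_mul_comm, Matrix.mul_assoc, hMN, Matrix.mul_one]
    exact hneg
  · rw [hσ', ← Matrix.mulVec_mulVec, hMψ, ← Matrix.mulVec_mulVec, hker, Matrix.mulVec_zero]

lemma kernel_orthogonal {N : Type*} [Fintype N] {k : ℕ} (p : Fin k → ℝ) (hp : ∀ i, 0 ≤ p i)
    (u : Fin k → N → ℂ) (x : N → ℂ)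
    (hx : (∑ i, (p i : ℂ) • vecMulVec (u i) (star (u i))) *ᵥ x = 0) (i : Fin k) (hi : 0 < p i) :
    star x ⬝ᵥ u i = 0 := by
  have h1 : ∑ i, p i * Complex.normSq (star x ⬝ᵥ u i) = 0 := by
    have h2 : star x ⬝ᵥ (∑ i, (p i : ℂ) • vecMulVec (u i) (star (u i))) *ᵥ x = 0 := by
      rw [hx, dotProduct_zero]
    have h3 : star x ⬝ᵥ (∑ i, (p i : ℂ) • vecMulVec (u i) (star (u i))) *ᵥ x =
        ((∑ i, p i * Complex.normSq (star x ⬝ᵥ u i) : ℝ) : ℂ) := by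
      rw [Matrix.sum_mulVec, dotProduct_sum]
      push_cast
      refine Finset.sum_congr rfl fun j _ => ?_
      rw [Matrix.smul_mulVec, dotProduct_smul, smul_eq_mul, vecMulVec_mulVec]
      have h4 : star (u j) ⬝ᵥ x = star (star x ⬝ᵥ u j) := by
        rw [star_dotProduct]
      rw [h4, Complex.normSq_eq_conj_mul_self]
      simp [dotProduct_smul]
    rw [h3] at h2
    exact_mod_cast h2
  rw [Finset.sum_eq_zero_iff_of_nonneg
    (fun i _ => mul_nonneg (hp i) (Complex.normSq_nonneg _))] at h1
  have h5 := h1 i (Finset.mem_univ i)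
  rcases mul_eq_zero.1 h5 with h | h
  · exact absurd h hi.ne'
  · exact Complex.normSq_eq_zero.1 h

/-- The range criterion. -/
lemma separable_range {m n : ℕ} {ρ : Matrix (Fin m × Fin n) (Fin m × Fin n) ℂ}
    (h : Separable ρ) : ∃ a b, prodVec a b ≠ (0 : Fin m × Fin n → ℂ) ∧
      (∀ x, ρ *ᵥ x = 0 → star x ⬝ᵥ prodVec a b = 0) ∧
      (∀ x, ptrans ρ *ᵥ x = 0 → star x ⬝ᵥ prodVec (star a) b = 0) := by
  obtain ⟨k, p, v, w, hp, hp1, hvw, hρ⟩ := h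
  obtain ⟨i, hi⟩ : ∃ i, 0 < p i := by
    by_contra! hcon
    have : ∑ i, p i ≤ 0 := Finset.sum_nonpos fun i _ => hcon i
    linarith
  have hpt : ptrans ρ = ∑ i, (p i : ℂ) •
      vecMulVec (prodVec (star (v i)) (w i)) (star (prodVec (star (v i)) (w i))) := by
    simp only [← ptrans_proj]
    rw [hρ]
    ext x y
    simp [ptrans, Matrix.sum_apply]
  refine ⟨v i, w i, ?_, ?_, ?_⟩
  · intro h0
    have := hvw i
    rw [h0] at this
    simp at this
  · intro x hx
    rw [hρ] at hx
    exact kernel_orthogonal p hp _ x hx i hi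
  · intro x hx
    rw [hpt] at hx
    exact kernel_orthogonal p hp (fun i => prodVec (star (v i)) (w i)) x hx i hi

lemma edge_witness {m n : ℕ} {τ : Matrix (Fin m × Fin n) (Fin m × Fin n) ℂ}
    (hτ : τ.IsHermitian) (r : ℝ) (hr : 0 < r) (htr : τ.trace = r)
    (hno : ∀ a b, (∀ x, τ *ᵥ x = 0 → star x ⬝ᵥ prodVec a b = 0) →
      (∀ x, ptrans τ *ᵥ x = 0 → star x ⬝ᵥ prodVec (star a) b = 0) → prodVec a b = 0) :
    ∃ W : Matrix (Fin m × Fin n) (Fin m × Fin n) ℂ,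
      BlockPositive W ∧ ((W * τ).trace).re < 0 := by
  have hr' : (r : ℂ) ≠ 0 := by exact_mod_cast hr.ne'
  have hH : (((r⁻¹ : ℝ) : ℂ) • τ).IsHermitian := by
    unfold Matrix.IsHermitian
    rw [conjTranspose_smul, hτ.eq]; simp
  have ht : (((r⁻¹ : ℝ) : ℂ) • τ).trace = 1 := by
    rw [Matrix.trace_smul, htr]; simp [hr']
  have hns : ¬ Separable (((r⁻¹ : ℝ) : ℂ) • τ) := by
    intro hsep
    obtain ⟨a, b, hab, h1, h2⟩ := separable_range hsep
    refine hab (hno a b (fun x hx => h1 x ?_) fun x hx => h2 x ?_)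
    · rw [Matrix.smul_mulVec, hx, smul_zero]
    · have : ptrans (((r⁻¹ : ℝ) : ℂ) • τ) = ((r⁻¹ : ℝ) : ℂ) • ptrans τ := rfl
      rw [this, Matrix.smul_mulVec, hx, smul_zero]
  obtain ⟨W, hW, hneg⟩ := exists_witness (((r⁻¹ : ℝ) : ℂ) • τ) hH ht hns
  refine ⟨W, hW, ?_⟩
  rw [Matrix.mul_smul, Matrix.trace_smul, smul_eq_mul, Complex.re_ofReal_mul] at hneg
  by_contra! hcon
  have : 0 ≤ r⁻¹ * ((W * τ).trace).re := by positivity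
  linarith

lemma alg33 (a b : Fin 3 → ℂ) (c0 c1 c2 : ℂ) (h0 : c0 = 0 ↔ a 0 = 0) (h1 : c1 = 0 ↔ a 1 = 0)
    (h2 : c2 = 0 ↔ a 2 = 0)
    (e1 : a 0 * b 1 + -(2 * (a 1 * b 0)) = 0) (e2 : a 1 * b 2 + -(2 * (a 2 * b 1)) = 0)
    (e3 : -(2 * (a 0 * b 2)) + a 2 * b 0 = 0)
    (f1 : c0 * b 0 + -(c1 * b 1) = 0) (f2 : c1 * b 1 + -(c2 * b 2) = 0) : prodVec a b = 0 := by
  have key : (a 0 * b 0) * (a 1 * b 1) * (a 2 * b 2) = 0 := by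
    have : (a 0 * b 1) * (a 1 * b 2) * (a 2 * b 0) =
        (2 * (a 1 * b 0)) * (2 * (a 2 * b 1)) * (2 * (a 0 * b 2)) := by
      rw [add_neg_eq_zero.1 e1, add_neg_eq_zero.1 e2, neg_add_eq_zero.1 e3]
    linear_combination (-1 / 7 : ℂ) * this
  have g1 : c0 * b 0 = c1 * b 1 := add_neg_eq_zero.1 f1
  have g2 : c1 * b 1 = c2 * b 2 := add_neg_eq_zero.1 f2
  have hk : a 0 * b 0 = 0 ∧ a 1 * b 1 = 0 ∧ a 2 * b 2 = 0 := by
    have k0 : c0 * b 0 = 0 ↔ a 0 * b 0 = 0 := by simp [h0]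
    have k1 : c1 * b 1 = 0 ↔ a 1 * b 1 = 0 := by simp [h1]
    have k2 : c2 * b 2 = 0 ↔ a 2 * b 2 = 0 := by simp [h2]
    rw [← k0, ← k1, ← k2]
    rcases mul_eq_zero.1 key with h | h
    · rcases mul_eq_zero.1 h with h | h
      · have := k0.2 h; exact ⟨this, g1 ▸ this, g2 ▸ g1 ▸ this⟩
      · have := k1.2 h; exact ⟨g1.trans this, this, g2 ▸ this⟩
    · have := k2.2 h; exact ⟨(g1.trans g2).trans this, g2.trans this, this⟩
  obtain ⟨k0, k1, k2⟩ := hk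
  have hab : a 0 = 0 ∧ a 1 = 0 ∧ a 2 = 0 ∨ b 0 = 0 ∧ b 1 = 0 ∧ b 2 = 0 := by
    by_cases z0 : a 0 = 0
    · by_cases z1 : a 1 = 0
      · by_cases z2 : a 2 = 0
        · exact Or.inl ⟨z0, z1, z2⟩
        · simp_all
      · simp_all
    · simp_all
  ext ⟨i, k⟩
  rcases hab with ⟨x, y, z⟩ | ⟨x, y, z⟩
  · fin_cases i <;> simp [prodVec, x, y, z]
  · fin_cases k <;> simp [prodVec, x, y, z]

lemma alg24 (a : Fin 2 → ℂ) (b : Fin 4 → ℂ) (c0 c1 : ℂ) (h0 : c0 = 0 ↔ a 0 = 0)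
    (h1 : c1 = 0 ↔ a 1 = 0)
    (e1 : a 0 * b 2 + -(a 1 * b 1) = 0) (e2 : a 0 * b 3 + -(a 1 * b 2) = 0)
    (e3 : -(2 * (a 0 * b 1)) + (2 * (a 1 * b 0) + -(a 1 * b 3)) = 0)
    (f1 : c0 * b 0 + -(c1 * b 1) = 0) (f2 : c0 * b 1 + -(c1 * b 2) = 0)
    (f3 : 2 * (c0 * b 2) + (c1 * b 0 + -(2 * (c1 * b 3))) = 0) : prodVec a b = 0 := by
  have hab : (a 0 = 0 ∧ a 1 = 0) ∨ (b 0 = 0 ∧ b 1 = 0 ∧ b 2 = 0 ∧ b 3 = 0) := by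
    by_cases z1 : a 1 = 0
    · have w1 := h1.2 z1
      by_cases z0 : a 0 = 0
      · exact Or.inl ⟨z0, z1⟩
      · simp_all
    · have w1 : c1 ≠ 0 := fun h => z1 (h1.1 h)
      right
      by_cases z0 : a 0 = 0
      · have w0 := h0.2 z0
        simp only [z0, w0, zero_mul, mul_zero, neg_zero, zero_add, neg_eq_zero, mul_eq_zero, z1, w1,
          false_or] at e1 e2 f1 f2 e3 f3
        have e3' : 2 * b 0 - b 3 = 0 := by
          apply mul_left_cancel₀ z1; linear_combination e3
        have f3' : b 0 - 2 * b 3 = 0 := by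
          apply mul_left_cancel₀ w1; linear_combination f3
        refine ⟨?_, e1, e2, ?_⟩
        · linear_combination (2 / 3 : ℂ) * e3' - (1 / 3 : ℂ) * f3'
        · linear_combination (1 / 3 : ℂ) * e3' - (2 / 3 : ℂ) * f3'
      · have w0 : c0 ≠ 0 := fun h => z0 (h0.1 h)
        by_cases y0 : b 0 = 0
        · simp_all
        · exfalso
          have y1 : b 1 ≠ 0 := by
            intro h; simp_all
          have s : a 0 * c0 - a 1 * c1 = 0 := by
            apply mul_right_cancel₀ y1
            linear_combination c1 * e1 + a 0 * f2
          have y2 : b 2 ≠ 0 := by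
            intro h; simp_all
          have t : a 0 * c1 * b 0 = 0 := by
            linear_combination a 0 * f3 - 2 * b 2 * s + 2 * c1 * e2
          simp_all
  ext ⟨i, k⟩
  rcases hab with ⟨x, y⟩ | ⟨x, y, z, w⟩
  · fin_cases i <;> simp [prodVec, x, y]
  · fin_cases k <;> simp [prodVec, x, y, z, w]

lemma psd_of_int {N : Type*} [Fintype N] {k : ℕ} (B : Matrix (Fin k) N ℤ) (w : Fin k → ℤ)
    (hw : ∀ i, 0 ≤ w i) (G : Matrix N N ℤ) (hG : G = Bᵀ * diagonal w * B) :
    (G.map (Int.cast : ℤ → ℂ)).PosSemidef := by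
  have h1 : G.map (Int.cast : ℤ → ℂ) =
      (B.map (Int.cast : ℤ → ℂ))ᴴ * diagonal (fun i => ((w i : ℤ) : ℂ)) *
        B.map (Int.cast : ℤ → ℂ) := by
    rw [hG]
    ext x y
    simp [Matrix.mul_apply, Matrix.diagonal_apply]
  rw [h1]
  apply PosSemidef.conjTranspose_mul_mul_same
  apply PosSemidef.diagonal
  intro i
  simp only [Pi.zero_apply]
  exact_mod_cast hw i

lemma int_kernel {N : Type*} [Fintype N] {G : Matrix N N ℤ} {x : N → ℤ} (h : G *ᵥ x = 0) :
    G.map (Int.cast : ℤ → ℂ) *ᵥ (fun i => (x i : ℂ)) = 0 := by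
  ext i
  have h1 := congrFun h i
  simp only [mulVec, dotProduct, Pi.zero_apply, Matrix.map_apply] at h1 ⊢
  exact_mod_cast h1

lemma orth_of_int {N : Type*} [Fintype N] {G : Matrix N N ℤ} {v : N → ℂ}
    (hG : ∀ x, G.map (Int.cast : ℤ → ℂ) *ᵥ x = 0 → star x ⬝ᵥ v = 0) (x : N → ℤ)
    (h : G *ᵥ x = 0) : ∑ i, (x i : ℂ) * v i = 0 := by
  have := hG _ (int_kernel h)
  simpa [dotProduct] using this

/-- Integer partial transpose. -/
def iptrans {m n : ℕ} (M : Matrix (Fin m × Fin n) (Fin m × Fin n) ℤ) :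
    Matrix (Fin m × Fin n) (Fin m × Fin n) ℤ :=
  Matrix.of fun p q => M (q.1, p.2) (p.1, q.2)

lemma ptrans_cast {m n : ℕ} (M : Matrix (Fin m × Fin n) (Fin m × Fin n) ℤ) :
    ptrans (M.map (Int.cast : ℤ → ℂ)) = (iptrans M).map (Int.cast : ℤ → ℂ) := rfl

/-- Factor of the `3 × 3` edge state. -/
def B33 : Matrix (Fin 6) (Fin 3 × Fin 3) ℤ := Matrix.of fun i p =>
  (![![![0, 2, 0], ![1, 0, 0], ![0, 0, 0]],
     ![![0, 0, 0], ![0, 0, 2], ![0, 1, 0]],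
     ![![0, 0, 1], ![0, 0, 0], ![2, 0, 0]],
     ![![1, 0, 0], ![0, 0, 0], ![0, 0, 0]],
     ![![0, 0, 0], ![0, 1, 0], ![0, 0, 0]],
     ![![0, 0, 0], ![0, 0, 0], ![0, 0, 1]]] : Fin 6 → Fin 3 → Fin 3 → ℤ) i p.1 p.2

/-- Factor of the partial transpose of the `3 × 3` edge state. -/
def C33 : Matrix (Fin 7) (Fin 3 × Fin 3) ℤ := Matrix.of fun i p =>
  (![![![1, 0, 0], ![0, 1, 0], ![0, 0, 1]],
     ![![0, 1, 0], ![0, 0, 0], ![0, 0, 0]],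
     ![![0, 0, 0], ![0, 0, 1], ![0, 0, 0]],
     ![![0, 0, 0], ![0, 0, 0], ![1, 0, 0]],
     ![![0, 0, 0], ![1, 0, 0], ![0, 0, 0]],
     ![![0, 0, 0], ![0, 0, 0], ![0, 1, 0]],
     ![![0, 0, 1], ![0, 0, 0], ![0, 0, 0]]] : Fin 7 → Fin 3 → Fin 3 → ℤ) i p.1 p.2

/-- The `3 × 3` edge state. -/
def T33 : Matrix (Fin 3 × Fin 3) (Fin 3 × Fin 3) ℤ := Matrix.of fun p q =>
  if p = q then (![![2, 4, 1], ![1, 2, 4], ![4, 1, 2]] : Fin 3 → Fin 3 → ℤ) p.1 p.2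
  else if p.1 = q.2 ∧ p.2 = q.1 then 2 else 0

lemma T33_eq : T33 = B33ᵀ * diagonal (![1, 1, 1, 2, 2, 2] : Fin 6 → ℤ) * B33 := by
  decide +kernel

lemma T33_ptrans : iptrans T33 = C33ᵀ * diagonal (![2, 4, 4, 4, 1, 1, 1] : Fin 7 → ℤ) * C33 := by
  decide +kernel

/-- Factor of the `2 × 4` edge state. -/
def B24 : Matrix (Fin 5) (Fin 2 × Fin 4) ℤ := Matrix.of fun i p =>
  (![![![1, 0, 0, 0], ![0, 0, 0, 0]],
     ![![0, 1, 0, 0], ![1, 0, 0, 0]],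
     ![![0, 0, 1, 0], ![0, 1, 0, 0]],
     ![![0, 0, 0, 1], ![0, 0, 1, 0]],
     ![![0, 0, 0, 0], ![1, 0, 0, 2]]] : Fin 5 → Fin 2 → Fin 4 → ℤ) i p.1 p.2

/-- Factor of the partial transpose of the `2 × 4` edge state. -/
def C24 : Matrix (Fin 5) (Fin 2 × Fin 4) ℤ := Matrix.of fun i p =>
  (![![![1, 0, 0, 0], ![0, 1, 0, 0]],
     ![![0, 1, 0, 0], ![0, 0, 1, 0]],
     ![![0, 0, 1, 0], ![0, 0, 0, 1]],
     ![![0, 0, 0, 1], ![0, 0, 0, 0]],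
     ![![0, 0, 0, 0], ![2, 0, 0, 1]]] : Fin 5 → Fin 2 → Fin 4 → ℤ) i p.1 p.2

/-- The `2 × 4` edge state (a member of the Horodecki family). -/
def T24 : Matrix (Fin 2 × Fin 4) (Fin 2 × Fin 4) ℤ := B24ᵀ * diagonal (![3, 3, 3, 3, 1] : Fin 5 → ℤ) * B24

lemma T24_ptrans : iptrans T24 = C24ᵀ * diagonal (![3, 3, 3, 3, 1] : Fin 5 → ℤ) * C24 := by
  decide +kernel

/-- A PPT entangled state, with a block-positive matrix detecting it, whose partial transpose
annihilates a vector of full Schmidt rank. -/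
def EdgePair (p q : ℕ) (hpq : p ≤ q) : Prop :=
  ∃ (τ W₁ : Matrix (Fin p × Fin q) (Fin p × Fin q) ℂ) (X₀ : Matrix (Fin q) (Fin q) ℂ),
    τ.PosSemidef ∧ (ptrans τ).PosSemidef ∧ BlockPositive W₁ ∧ ((W₁ * τ).trace).re < 0 ∧
    X₀.det ≠ 0 ∧ ptrans τ *ᵥ (fun x => X₀ (Fin.castLE hpq x.1) x.2) = 0

lemma edge33 : EdgePair 3 3 le_rfl := by
  have hτ : (T33.map (Int.cast : ℤ → ℂ)).PosSemidef :=
    psd_of_int B33 ![1, 1, 1, 2, 2, 2] (by decide) T33 T33_eq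
  have hτ' : (ptrans (T33.map (Int.cast : ℤ → ℂ))).PosSemidef := by
    rw [ptrans_cast]
    exact psd_of_int C33 ![2, 4, 4, 4, 1, 1, 1] (by decide) _ T33_ptrans
  obtain ⟨W₁, hW₁, hneg⟩ := edge_witness hτ.1 21 (by norm_num) (by
      have h : T33.trace = 21 := by decide +kernel
      have h2 : (T33.map (Int.cast : ℤ → ℂ)).trace = ((T33.trace : ℤ) : ℂ) := by
        simp [Matrix.trace]
      rw [h2, h]; norm_num) (by
    intro a b h1 h2
    rw [ptrans_cast] at h2
    have e1 := orth_of_int h1 (fun p => (![![0, 1, 0], ![-2, 0, 0], ![0, 0, 0]] :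
      Fin 3 → Fin 3 → ℤ) p.1 p.2) (by decide +kernel)
    have e2 := orth_of_int h1 (fun p => (![![0, 0, 0], ![0, 0, 1], ![0, -2, 0]] :
      Fin 3 → Fin 3 → ℤ) p.1 p.2) (by decide +kernel)
    have e3 := orth_of_int h1 (fun p => (![![0, 0, -2], ![0, 0, 0], ![1, 0, 0]] :
      Fin 3 → Fin 3 → ℤ) p.1 p.2) (by decide +kernel)
    have f1 := orth_of_int h2 (fun p => (![![1, 0, 0], ![0, -1, 0], ![0, 0, 0]] :
      Fin 3 → Fin 3 → ℤ) p.1 p.2) (by decide +kernel)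
    have f2 := orth_of_int h2 (fun p => (![![0, 0, 0], ![0, 1, 0], ![0, 0, -1]] :
      Fin 3 → Fin 3 → ℤ) p.1 p.2) (by decide +kernel)
    simp [Fintype.sum_prod_type, Fin.sum_univ_succ, prodVec] at e1 e2 e3 f1 f2
    exact alg33 a b _ _ _ (by simp) (by simp) (by simp) e1 e2 e3 f1 f2)
  refine ⟨_, W₁, diagonal ![1, 1, -2], hτ, hτ', hW₁, hneg, ?_, ?_⟩
  · simp [Fin.prod_univ_succ]
  · rw [ptrans_cast]
    convert int_kernel (G := iptrans T33) (x := fun x => (diagonal ![1, 1, -2] :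
      Matrix (Fin 3) (Fin 3) ℤ) x.1 x.2) (by decide +kernel) using 2
    ext ⟨i, k⟩
    fin_cases i <;> fin_cases k <;> simp [diagonal]

lemma edge24 : EdgePair 2 4 (by norm_num) := by
  have hτ : (T24.map (Int.cast : ℤ → ℂ)).PosSemidef :=
    psd_of_int B24 ![3, 3, 3, 3, 1] (by decide) T24 rfl
  have hτ' : (ptrans (T24.map (Int.cast : ℤ → ℂ))).PosSemidef := by
    rw [ptrans_cast]
    exact psd_of_int C24 ![3, 3, 3, 3, 1] (by decide) _ T24_ptrans
  obtain ⟨W₁, hW₁, hneg⟩ := edge_witness hτ.1 26 (by norm_num) (by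
      have h : T24.trace = 26 := by decide +kernel
      have h2 : (T24.map (Int.cast : ℤ → ℂ)).trace = ((T24.trace : ℤ) : ℂ) := by
        simp [Matrix.trace]
      rw [h2, h]; norm_num) (by
    intro a b h1 h2
    rw [ptrans_cast] at h2
    have e1 := orth_of_int h1 (fun p => (![![0, 0, 1, 0], ![0, -1, 0, 0]] :
      Fin 2 → Fin 4 → ℤ) p.1 p.2) (by decide +kernel)
    have e2 := orth_of_int h1 (fun p => (![![0, 0, 0, 1], ![0, 0, -1, 0]] :
      Fin 2 → Fin 4 → ℤ) p.1 p.2) (by decide +kernel)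
    have e3 := orth_of_int h1 (fun p => (![![0, -2, 0, 0], ![2, 0, 0, -1]] :
      Fin 2 → Fin 4 → ℤ) p.1 p.2) (by decide +kernel)
    have f1 := orth_of_int h2 (fun p => (![![1, 0, 0, 0], ![0, -1, 0, 0]] :
      Fin 2 → Fin 4 → ℤ) p.1 p.2) (by decide +kernel)
    have f2 := orth_of_int h2 (fun p => (![![0, 1, 0, 0], ![0, 0, -1, 0]] :
      Fin 2 → Fin 4 → ℤ) p.1 p.2) (by decide +kernel)
    have f3 := orth_of_int h2 (fun p => (![![0, 0, 2, 0], ![1, 0, 0, -2]] :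
      Fin 2 → Fin 4 → ℤ) p.1 p.2) (by decide +kernel)
    simp [Fintype.sum_prod_type, Fin.sum_univ_succ, prodVec] at e1 e2 e3 f1 f2 f3
    exact alg24 a b _ _ (by simp) (by simp) e1 e2 e3 f1 f2 f3)
  refine ⟨_, W₁, diagonal ![1, -1, 1, 1], hτ, hτ', hW₁, hneg, ?_, ?_⟩
  · simp [Fin.prod_univ_succ]
  · rw [ptrans_cast]
    convert int_kernel (G := iptrans T24) (x := fun x => (diagonal ![1, -1, 1, 1] :
      Matrix (Fin 4) (Fin 4) ℤ) (Fin.castLE (by norm_num) x.1) x.2) (by decide +kernel) using 2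
    ext ⟨i, k⟩
    fin_cases i <;> fin_cases k <;> simp [diagonal]

/-- Exchange of the two tensor factors. -/
def swapM {m n : ℕ} (M : Matrix (Fin m × Fin n) (Fin m × Fin n) ℂ) :
    Matrix (Fin n × Fin m) (Fin n × Fin m) ℂ := M.submatrix Prod.swap Prod.swap

lemma swapM_swapM {m n : ℕ} (M : Matrix (Fin m × Fin n) (Fin m × Fin n) ℂ) :
    swapM (swapM M) = M := rfl

lemma ptrans_swapM {m n : ℕ} (M : Matrix (Fin m × Fin n) (Fin m × Fin n) ℂ) :
    ptrans (swapM M) = (swapM (ptrans M))ᵀ := rfl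

lemma swapM_ptrans {m n : ℕ} (M : Matrix (Fin m × Fin n) (Fin m × Fin n) ℂ) :
    swapM (ptrans M) = ptrans (swapM Mᵀ) := rfl

lemma swapM_psd {m n : ℕ} {M : Matrix (Fin m × Fin n) (Fin m × Fin n) ℂ}
    (h : M.PosSemidef) : (swapM M).PosSemidef := h.submatrix _

lemma trace_swapM_mul {m n : ℕ} (W : Matrix (Fin n × Fin m) (Fin n × Fin m) ℂ)
    (M : Matrix (Fin m × Fin n) (Fin m × Fin n) ℂ) :
    (swapM W * M).trace = (W * swapM M).trace := by
  simp only [Matrix.trace, Matrix.diag, Matrix.mul_apply]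
  rw [← (Equiv.prodComm (Fin m) (Fin n)).sum_comp]
  refine Finset.sum_congr rfl fun x _ => ?_
  rw [← (Equiv.prodComm (Fin m) (Fin n)).sum_comp]
  rfl

lemma BlockPositive.swapM {m n : ℕ} {W : Matrix (Fin m × Fin n) (Fin m × Fin n) ℂ}
    (h : BlockPositive W) : BlockPositive (swapM W) := by
  refine ⟨h.1.submatrix _, fun a b => ?_⟩
  rw [← trace_mul_proj, trace_swapM_mul]
  have : _root_.swapM (vecMulVec (prodVec a b) (star (prodVec a b))) =
      vecMulVec (prodVec b a) (star (prodVec b a)) := by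
    ext p q
    simp [_root_.swapM, vecMulVec_apply, prodVec]
    ring
  rw [this, trace_mul_proj]
  exact h.2 b a

lemma Decomposable.swapM {m n : ℕ} {W : Matrix (Fin m × Fin n) (Fin m × Fin n) ℂ}
    (h : Decomposable W) : Decomposable (swapM W) := by
  obtain ⟨P, Q, hP, hQ, rfl⟩ := h
  exact ⟨_root_.swapM P, _root_.swapM Qᵀ, swapM_psd hP, swapM_psd hQ.transpose, rfl⟩

lemma npt_case {m n : ℕ} (hm : 2 ≤ m) (hle : m ≤ n) (hmn : 6 < m * n)
    (ρ : Matrix (Fin m × Fin n) (Fin m × Fin n) ℂ)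
    (hρ : ρ.IsHermitian) (hnpt : ¬ (ptrans ρ).PosSemidef) :
    ∃ W : Matrix (Fin m × Fin n) (Fin m × Fin n) ℂ,
      BlockPositive W ∧ ¬ Decomposable W ∧ ((W * ρ).trace).re < 0 := by
  obtain ⟨φ, hφ⟩ : ∃ φ, (star φ ⬝ᵥ ptrans ρ *ᵥ φ).re < 0 := by
    by_contra! hcon
    apply hnpt
    refine PosSemidef.of_dotProduct_mulVec_nonneg (ptrans_herm hρ) fun x => ?_
    rw [Complex.le_def]
    refine ⟨hcon x, ?_⟩
    have h5 : star (star x ⬝ᵥ ptrans ρ *ᵥ x) = star x ⬝ᵥ ptrans ρ *ᵥ x := by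
      rw [← star_dotProduct, star_mulVec, (ptrans_herm hρ).eq, dotProduct_mulVec]
    exact (Complex.conj_eq_iff_im.1 h5).symm
  rcases Nat.lt_or_ge m 3 with h | h
  · obtain ⟨τ, W₁, X₀, h1, h2, h3, h4, h5, h6⟩ := edge24
    have hn4 : 4 ≤ n := by
      have : m = 2 := by omega
      subst this; omega
    exact lift_detect hm hn4 (by norm_num) h1 h2 h3 h4 X₀ h5 h6 ρ φ hφ
  · obtain ⟨τ, W₁, X₀, h1, h2, h3, h4, h5, h6⟩ := edge33
    exact lift_detect h (h.trans hle) le_rfl h1 h2 h3 h4 X₀ h5 h6 ρ φ hφ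

/-- Any entangled state in an `m × n` system with `mn > 6` is detected by a
nondecomposable entanglement witness. -/
theorem stmt_19 {m n : ℕ} (hm : 2 ≤ m) (hn : 2 ≤ n) (hmn : 6 < m * n)
    (ρ : Matrix (Fin m × Fin n) (Fin m × Fin n) ℂ)
    (hρ : ρ.PosSemidef) (htr : ρ.trace = 1) (hent : ¬ Separable ρ) :
    ∃ W : Matrix (Fin m × Fin n) (Fin m × Fin n) ℂ,
      BlockPositive W ∧ ¬ Decomposable W ∧ ((W * ρ).trace).re < 0 := by
  by_cases hppt : (ptrans ρ).PosSemidef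
  · obtain ⟨W, hW, hneg⟩ := exists_witness ρ hρ.1 htr hent
    exact ⟨W, hW, not_decomposable_of_ppt hρ hppt hneg, hneg⟩
  · rcases le_total m n with hle | hle
    · exact npt_case hm hle hmn ρ hρ.1 hppt
    · obtain ⟨W, hW, hnd, hneg⟩ := npt_case hn hle (by rwa [mul_comm]) (swapM ρ)
        (swapM_psd hρ).1 (by
          intro h
          apply hppt
          rw [ptrans_swapM, posSemidef_transpose_iff] at h
          exact swapM_psd h)
      refine ⟨swapM W, hW.swapM, fun h => hnd h.swapM, ?_⟩
      rw [trace_swapM_mul]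
      exact hneg

end
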